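/- There exist universal constants C, c > 0 such that for all integers t ≥ 1, d ≥ 0 and every ε ∈ (0,1), there is a sample size m ≤ C·t(d+1)·(log(t(d+1)/ε))^c / ε² and a learning algorithm A using m samples over [−1,1) such that: for every probability distribution p over [−1,1) (with no well-behavedness assumption), with probability at least 9/10 over m i.i.d. samples s drawn from p, A(s) is a (2t−1)-piecewise degree-d distribution satisfying d_TV(p, A(s)) ≤ 4·opt_{t,d}(p)·(1+ε) + C·ε. (Theorem thm:no-wb.) -/

import Mathlib

open MeasureTheory Set
open scoped ENNReal

noncomputable def tvDist (p q : Measure ℝ) : ℝ :=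
  ⨆ A : {S : Set ℝ // MeasurableSet S}, |(p A.1).toReal - (q A.1).toReal|

def IsPiecewisePoly (a b : ℝ) (t d : ℕ) (f : ℝ → ℝ) : Prop :=
  ∃ x : Fin (t + 1) → ℝ, x 0 = a ∧ x (Fin.last t) = b ∧ Monotone x ∧
    ∀ i : Fin t, ∃ P : Polynomial ℝ, P.natDegree ≤ d ∧
      ∀ y ∈ Set.Ico (x i.castSucc) (x i.succ), f y = P.eval y

def IsPiecewisePolyDist (q : Measure ℝ) (a b : ℝ) (t d : ℕ) : Prop :=
  IsProbabilityMeasure q ∧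
  ∃ f : ℝ → ℝ, (∀ y ∈ Set.Ico a b, 0 ≤ f y) ∧
    q = (volume.restrict (Set.Ico a b)).withDensity (fun y => ENNReal.ofReal (f y)) ∧
    IsPiecewisePoly a b t d f

noncomputable def optTD (p : Measure ℝ) (t d : ℕ) : ℝ :=
  sInf {x : ℝ | ∃ q : Measure ℝ, IsPiecewisePolyDist q (-1) 1 t d ∧ x = tvDist p q}

noncomputable def samples (p : Measure ℝ) (m : ℕ) : Measure (Fin m → ℝ) :=
  Measure.pi fun _ => p


/-- The position of `x` relative to the points `u i`: twice the number of points strictly below `x`,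
plus the number of points equal to `x`. -/
noncomputable def rank {ι α : Type*} [Fintype ι] [LinearOrder α] (u : ι → α) (x : α) : ℕ :=
  (Finset.univ.filter fun i => u i < x).card + (Finset.univ.filter fun i => u i ≤ x).card

/-- Membership in `A` can change only at the points `u i`. -/
def SwitchesAt {ι : Type*} (u : ι → ℝ) (A : Set ℝ) : Prop :=
  ∀ x y, x ≤ y → (∀ i, u i ∉ Icc x y) → (x ∈ A ↔ y ∈ A)

lemma SwitchesAt.compl {ι : Type*} {u : ι → ℝ} {A : Set ℝ} (h : SwitchesAt u A) :
    SwitchesAt u Aᶜ :=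
  fun x y hxy hu => not_congr (h x y hxy hu)

section Rank

variable {ι α : Type*} [Fintype ι] [LinearOrder α] (u : ι → α)

lemma rank_mono : Monotone (rank u) := by
  intro x y hxy
  refine add_le_add (Finset.card_le_card ?_) (Finset.card_le_card ?_)
  · exact Finset.monotone_filter_right _ fun i _ hi => lt_of_lt_of_le hi hxy
  · exact Finset.monotone_filter_right _ fun i _ hi => le_trans hi hxy

lemma rank_lt (x : α) : rank u x < 2 * Fintype.card ι + 1 := by
  have h1 := Finset.card_le_univ (Finset.univ.filter fun i => u i < x)
  have h2 := Finset.card_le_univ (Finset.univ.filter fun i => u i ≤ x)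
  unfold rank
  omega

variable {u}

lemma notMem_Icc_of_rank_eq {x y : α} (hxy : x < y) (h : rank u x = rank u y) (i : ι) :
    u i ∉ Icc x y := by
  intro hi
  have s1 : (Finset.univ.filter fun i => u i < x) ⊆ (Finset.univ.filter fun i => u i < y) :=
    Finset.monotone_filter_right _ fun i _ hi => lt_trans hi hxy
  have s2 : (Finset.univ.filter fun i => u i ≤ x) ⊆ (Finset.univ.filter fun i => u i ≤ y) :=
    Finset.monotone_filter_right _ fun i _ hi => le_trans hi hxy.le
  have c1 := Finset.card_le_card s1
  have c2 := Finset.card_le_card s2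
  unfold rank at h
  have e1 := Finset.eq_of_subset_of_card_le s1 (by omega)
  have e2 := Finset.eq_of_subset_of_card_le s2 (by omega)
  have f1 := Finset.ext_iff.1 e1 i
  have f2 := Finset.ext_iff.1 e2 i
  simp only [Finset.mem_filter, Finset.mem_univ, true_and] at f1 f2
  exact absurd (f1.2 (lt_of_le_of_lt (f2.2 hi.2) hxy)) (not_lt.2 hi.1)

end Rank

/-- Membership in `A` agrees at `x` and `y` unless a switching point lies between them. -/
lemma SwitchesAt.iff_of_uIcc {ι : Type*} {u : ι → ℝ} {A : Set ℝ} (h : SwitchesAt u A) (x y : ℝ)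
    (hu : ∀ i, u i ∉ uIcc x y) : x ∈ A ↔ y ∈ A := by
  rcases le_total x y with hxy | hxy
  · exact h x y hxy (by simpa [uIcc_of_le hxy] using hu)
  · exact (h y x hxy (by simpa [uIcc_of_ge hxy] using hu)).symm

lemma exists_quantiles (p : Measure ℝ) [IsProbabilityMeasure p] (N : ℕ) (hN : 0 < N) :
    ∃ q : Fin N → ℝ, ∀ x y, x ≤ y → (∀ j, q j ∉ Icc x y) → p.real (Ioc x y) ≤ 1 / N := by
  set F := ProbabilityTheory.cdf p
  have hN' : (0 : ℝ) < N := by exact_mod_cast hN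
  refine ⟨fun j => sInf {z | (j : ℝ) / N ≤ F z}, fun x y hxy hq => ?_⟩
  have hF : p.real (Ioc x y) = F y - F x := by
    rw [ProbabilityTheory.cdf_eq_real, ProbabilityTheory.cdf_eq_real,
      ← measureReal_sdiff (Iic_subset_Iic.2 hxy) measurableSet_Iic]
    congr 1
    ext z
    simp [and_comm]
  rw [hF]
  have h0 : 0 ≤ F x := ProbabilityTheory.cdf_nonneg p x
  have hy1 : F y ≤ 1 := ProbabilityTheory.cdf_le_one p y
  set j := ⌊N * F x⌋₊ + 1 with hj
  have hj1 : (N : ℝ) * F x < j := by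
    rw [hj]; push_cast; exact Nat.lt_floor_add_one _
  have hj2 : (j : ℝ) ≤ N * F x + 1 := by
    rw [hj]; push_cast
    have := Nat.floor_le (mul_nonneg hN'.le h0)
    linarith
  have hj3 : (j : ℝ) / N ≤ F x + 1 / N := by
    rw [div_le_iff₀ hN', add_mul, one_div, inv_mul_cancel₀ hN'.ne']
    linarith
  have hj4 : F x < (j : ℝ) / N := by
    rw [lt_div_iff₀ hN']; linarith
  suffices F y ≤ j / N by linarith
  by_cases hjN : j < N
  · have hlt : (j : ℝ) / N < 1 := by
      rw [div_lt_one hN']; exact_mod_cast hjN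
    have hpos : (0 : ℝ) < (j : ℝ) / N := by positivity
    have hne : {z | (j : ℝ) / N ≤ F z}.Nonempty :=
      ((ProbabilityTheory.tendsto_cdf_atTop p).eventually (lt_mem_nhds hlt)).exists.imp
        fun z hz => le_of_lt hz
    have hbdd : BddBelow {z | (j : ℝ) / N ≤ F z} := by
      obtain ⟨w, hw⟩ :=
        ((ProbabilityTheory.tendsto_cdf_atBot p).eventually (gt_mem_nhds hpos)).exists
      refine ⟨w, fun z hz => ?_⟩
      by_contra hlt
      exact absurd (lt_of_le_of_lt (le_trans hz (ProbabilityTheory.monotone_cdf p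
        (not_le.1 hlt).le)) hw) (lt_irrefl _)
    have hx : x ≤ sInf {z | (j : ℝ) / N ≤ F z} := by
      refine le_csInf hne fun z hz => ?_
      by_contra hlt
      exact absurd (lt_of_le_of_lt (le_trans hz (ProbabilityTheory.monotone_cdf p
        (not_le.1 hlt).le)) hj4) (lt_irrefl _)
    have hyq : y < sInf {z | (j : ℝ) / N ≤ F z} := by
      by_contra hlt
      exact hq ⟨j, hjN⟩ ⟨hx, not_lt.1 hlt⟩
    by_contra hlt
    exact absurd (csInf_le hbdd (not_le.1 hlt).le) (not_le.2 hyq)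
  · refine hy1.trans ?_
    rw [le_div_iff₀ hN', one_mul]
    exact_mod_cast not_lt.1 hjN

lemma measure_le_of_avoids_quantiles {p : Measure ℝ} [IsProbabilityMeasure p] {N : ℕ}
    {q : Fin N → ℝ}
    (hq : ∀ x y, x ≤ y → (∀ j, q j ∉ Icc x y) → p.real (Ioc x y) ≤ 1 / N)
    {I : Set ℝ} (hI : MeasurableSet I)
    (hIq : ∀ x ∈ I, ∀ y ∈ I, x ≤ y → ∀ j, q j ∉ Icc x y) : p.real I ≤ 1 / N := by
  have hfin : p I ≠ ⊤ := measure_ne_top p I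
  refine ENNReal.toReal_le_of_le_ofReal (by positivity) ?_
  by_contra hlt
  obtain ⟨K, hKI, hK, hlt'⟩ := hI.exists_lt_isCompact (not_le.1 hlt)
  have hKne : K.Nonempty := by
    rw [nonempty_iff_ne_empty]; rintro rfl; simp at hlt'
  have hmin := hK.sInf_mem hKne
  have hmax := hK.sSup_mem hKne
  have hle : sInf K ≤ sSup K := csInf_le hK.bddBelow hmax
  have hev : ∀ᶠ a in nhdsWithin (sInf K) (Iio (sInf K)), ∀ j, q j ∉ Icc a (sInf K) := by
    rw [Filter.eventually_all]
    intro j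
    rcases lt_trichotomy (q j) (sInf K) with h | h | h
    · filter_upwards [nhdsWithin_le_nhds (lt_mem_nhds h)] with a ha hmem
      exact absurd hmem.1 (not_le.2 ha)
    · exact absurd ⟨h.ge, h.le⟩ (hIq _ (hKI hmin) _ (hKI hmin) le_rfl j)
    · exact Filter.Eventually.of_forall fun a hmem => absurd hmem.2 (not_le.2 h)
  obtain ⟨a, ha, haK⟩ := (hev.and self_mem_nhdsWithin).exists
  have haK : a < sInf K := haK
  have hav : ∀ j, q j ∉ Icc a (sSup K) := by
    intro j hj
    rcases le_total (q j) (sInf K) with h | h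
    · exact ha j ⟨hj.1, h⟩
    · exact hIq _ (hKI hmin) _ (hKI hmax) hle j ⟨h, hj.2⟩
  have h1 := hq a (sSup K) (haK.le.trans hle) hav
  have h2 : p K ≤ ENNReal.ofReal (1 / N) := by
    refine (measure_mono (t := Ioc a (sSup K)) fun z hz =>
      ⟨lt_of_lt_of_le haK (csInf_le hK.bddBelow hz), le_csSup hK.bddAbove hz⟩).trans ?_
    rw [← ENNReal.ofReal_toReal (measure_ne_top p (Ioc a (sSup K)))]
    exact ENNReal.ofReal_le_ofReal h1
  exact absurd hlt' (not_lt.2 h2)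

/-- The sets covering all sets with at most `R` switching points: unions of cells of the partition
given by `q`, determined by `R` cells and a set of relative positions. -/
def gridSet {N R : ℕ} (q : Fin N → ℝ) (c : (Fin R → Fin (2 * N + 1)) × Finset (Fin (2 * R + 1))) :
    Set ℝ :=
  {x | ∃ r ∈ c.2, (r : ℕ) = rank (fun i => (c.1 i : ℕ)) (rank q x)}

lemma measurableSet_gridSet {N R : ℕ} (q : Fin N → ℝ)
    (c : (Fin R → Fin (2 * N + 1)) × Finset (Fin (2 * R + 1))) : MeasurableSet (gridSet q c) := by
  have : gridSet q c = rank q ⁻¹' {k | ∃ r ∈ c.2, (r : ℕ) = rank (fun i => (c.1 i : ℕ)) k} := rfl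
  rw [this]
  exact (rank_mono q).measurable (MeasurableSet.of_discrete)

lemma exists_gridSet {p : Measure ℝ} [IsProbabilityMeasure p] {N R : ℕ}
    {q : Fin N → ℝ}
    (hq : ∀ x y, x ≤ y → (∀ j, q j ∉ Icc x y) → p.real (Ioc x y) ≤ 1 / N)
    {u : Fin R → ℝ} {A : Set ℝ} (hA : SwitchesAt u A) :
    ∃ c : (Fin R → Fin (2 * N + 1)) × Finset (Fin (2 * R + 1)),
      A ⊆ gridSet q c ∧ p.real (gridSet q c \ A) ≤ R / N := by
  classical
  have hlt : ∀ x, rank q x < 2 * N + 1 := fun x => by simpa using rank_lt q x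
  set e : Fin R → Fin (2 * N + 1) := fun i => ⟨rank q (u i), hlt _⟩ with he
  have hlt' : ∀ k, rank (fun i => (e i : ℕ)) k < 2 * R + 1 := fun k => by
    simpa using rank_lt (fun i => (e i : ℕ)) k
  refine ⟨(e, Finset.univ.filter fun r => ∃ x ∈ A, rank (fun i => (e i : ℕ)) (rank q x) = r),
    fun x hx => ⟨⟨_, hlt' (rank q x)⟩, ?_, rfl⟩, ?_⟩
  · simp only [Finset.mem_filter, Finset.mem_univ, true_and]
    exact ⟨x, hx, rfl⟩
  set bad : Fin R → Set ℝ := fun i =>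
    if (rank q ⁻¹' {rank q (u i)}).Subsingleton then ∅ else rank q ⁻¹' {rank q (u i)} with hbad
  have hbadle : ∀ i, p.real (bad i) ≤ 1 / N := by
    intro i
    simp only [hbad]
    split_ifs with hs
    · simp
    · refine measure_le_of_avoids_quantiles hq
        ((rank_mono q).measurable (MeasurableSet.of_discrete)) ?_
      rw [not_subsingleton_iff] at hs
      intro x hx y hy hxy j hj
      have key : ∀ z w, z < w → z ∈ rank q ⁻¹' {rank q (u i)} → w ∈ rank q ⁻¹' {rank q (u i)} →
          q j ∉ Icc z w := fun z w hzw hz hw =>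
        notMem_Icc_of_rank_eq hzw (Eq.trans hz (Eq.symm hw)) j
      rcases hxy.lt_or_eq with h | h
      · exact key x y h hx hy hj
      · obtain ⟨z, hz, hzx⟩ := hs.exists_ne x
        have hjx : q j = x := le_antisymm (h ▸ hj.2) hj.1
        rcases lt_or_gt_of_ne hzx with h' | h'
        · exact key z x h' hz hx ⟨hjx ▸ h'.le, hjx.le⟩
        · exact key x z h' hx hz ⟨hjx.ge, hjx ▸ h'.le⟩
  have hsub : gridSet q (e, Finset.univ.filter fun r =>
      ∃ x ∈ A, rank (fun i => (e i : ℕ)) (rank q x) = r) \ A ⊆ ⋃ i, bad i := by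
    rintro y ⟨⟨r, hr, hry⟩, hyA⟩
    simp only [Finset.mem_filter, Finset.mem_univ, true_and] at hr
    obtain ⟨x, hxA, hxr⟩ := hr
    have hu : ∃ i, u i ∈ uIcc x y := by
      by_contra hcon
      push Not at hcon
      exact hyA ((hA.iff_of_uIcc x y hcon).1 hxA)
    obtain ⟨i, hi⟩ := hu
    have hmem : rank q (u i) ∈ uIcc (rank q x) (rank q y) :=
      (rank_mono q).image_uIcc_subset ⟨_, hi, rfl⟩
    have heq : rank q x = rank q y := by
      by_contra hne
      have hrr := hxr.trans hry
      rcases lt_or_gt_of_ne hne with h | h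
      · exact notMem_Icc_of_rank_eq h hrr i (by simpa [uIcc_of_le h.le] using hmem)
      · exact notMem_Icc_of_rank_eq h hrr.symm i (by simpa [uIcc_of_ge h.le] using hmem)
    rw [heq, uIcc_self, mem_singleton_iff] at hmem
    refine mem_iUnion.2 ⟨i, ?_⟩
    have hns : ¬ (rank q ⁻¹' {rank q (u i)}).Subsingleton := by
      intro hs
      have : x = y := hs (by simp [heq, hmem]) (by simp [hmem])
      exact hyA (this ▸ hxA)
    simp only [hbad, if_neg hns]
    simp [hmem]
  calc _ ≤ p.real (⋃ i, bad i) := measureReal_mono hsub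
    _ ≤ ∑ i, p.real (bad i) := measureReal_iUnion_fintype_le _
    _ ≤ ∑ _i : Fin R, (1 : ℝ) / N := Finset.sum_le_sum fun i _ => hbadle i
    _ = R / N := by simp [div_eq_mul_inv]

/-- The fraction of the sample points `s i` that lie in `A`. -/
noncomputable def empFreq {m : ℕ} (s : Fin m → ℝ) (A : Set ℝ) : ℝ :=
  (∑ i, A.indicator (fun _ => (1 : ℝ)) (s i)) / m

lemma empFreq_mono {m : ℕ} (s : Fin m → ℝ) {A B : Set ℝ} (h : A ⊆ B) :
    empFreq s A ≤ empFreq s B := by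
  refine div_le_div_of_nonneg_right (Finset.sum_le_sum fun i _ => ?_) (Nat.cast_nonneg m)
  exact indicator_le_indicator_of_subset h (fun _ => zero_le_one) _

lemma empFreq_nonneg {m : ℕ} (s : Fin m → ℝ) (A : Set ℝ) : 0 ≤ empFreq s A :=
  div_nonneg (Finset.sum_nonneg fun _ _ => indicator_nonneg (fun _ _ => zero_le_one) _)
    (Nat.cast_nonneg m)

lemma empFreq_compl {m : ℕ} (hm : 0 < m) (s : Fin m → ℝ) (A : Set ℝ) :
    empFreq s Aᶜ = 1 - empFreq s A := by
  have hm' : (m : ℝ) ≠ 0 := by exact_mod_cast hm.ne'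
  unfold empFreq
  rw [eq_sub_iff_add_eq, ← add_div, ← Finset.sum_add_distrib]
  have : ∀ i, Aᶜ.indicator (fun _ => (1 : ℝ)) (s i) + A.indicator (fun _ => (1 : ℝ)) (s i) = 1 :=
    fun i => by by_cases h : s i ∈ A <;> simp [h]
  simp [this, hm']

lemma empFreq_le_one {m : ℕ} (s : Fin m → ℝ) (A : Set ℝ) : empFreq s A ≤ 1 := by
  rcases Nat.eq_zero_or_pos m with rfl | hm
  · simp [empFreq]
  · have := empFreq_nonneg s Aᶜ
    rw [empFreq_compl hm] at this
    linarith

lemma measurable_empFreq {m : ℕ} {A : Set ℝ} (hA : MeasurableSet A) :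
    Measurable fun s : Fin m → ℝ => empFreq s A := by
  unfold empFreq
  refine Measurable.div_const (Finset.measurable_sum _ fun i _ => ?_) _
  exact (measurable_const.indicator hA).comp (measurable_pi_apply i)

instance (p : Measure ℝ) [IsProbabilityMeasure p] (m : ℕ) : IsProbabilityMeasure (samples p m) := by
  unfold samples; infer_instance

lemma samples_empFreq_ge (p : Measure ℝ) [IsProbabilityMeasure p] {m : ℕ} (hm : 0 < m)
    {G : Set ℝ} (hG : MeasurableSet G) {ε : ℝ} (hε : 0 ≤ ε) :
    (samples p m).real {s | p.real G + ε ≤ empFreq s G} ≤ Real.exp (-2 * m * ε ^ 2) := by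
  have hm' : (0 : ℝ) < m := by exact_mod_cast hm
  set X : ℝ → ℝ := fun x => G.indicator (fun _ => (1 : ℝ)) x - p.real G with hX
  have hmeas : Measurable (G.indicator (fun _ : ℝ => (1 : ℝ))) := measurable_const.indicator hG
  have hXm : Measurable X := hmeas.sub_const _
  have hind : ProbabilityTheory.iIndepFun (fun (i : Fin m) (s : Fin m → ℝ) => X (s i))
      (samples p m) :=
    ProbabilityTheory.iIndepFun_pi (μ := fun _ => p) (X := fun _ => X) fun _ => hXm.aemeasurable
  have hsub : ∀ i ∈ (Finset.univ : Finset (Fin m)), ProbabilityTheory.HasSubgaussianMGF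
      (fun s : Fin m → ℝ => X (s i)) ((‖(1 : ℝ) - 0‖₊ / 2) ^ 2) (samples p m) := by
    intro i _
    have h := ProbabilityTheory.hasSubgaussianMGF_of_mem_Icc (μ := p) hmeas.aemeasurable
      (a := 0) (b := 1) (Filter.Eventually.of_forall fun x => by
        by_cases h : x ∈ G <;> simp [h])
    rw [show (∫ x, G.indicator (fun _ : ℝ => (1 : ℝ)) x ∂p) = p.real G by
      rw [integral_indicator_const _ hG]; simp] at h
    refine ProbabilityTheory.HasSubgaussianMGF.of_map (X := X) (Y := fun s : Fin m → ℝ => s i)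
      (measurable_pi_apply i).aemeasurable ?_
    rw [samples, (measurePreserving_eval (fun _ : Fin m => p) i).map_eq]
    exact h
  have := ProbabilityTheory.HasSubgaussianMGF.measure_sum_ge_le_of_iIndepFun hind hsub
    (ε := m * ε) (by positivity)
  refine le_trans (measureReal_mono fun s hs => ?_) (this.trans_eq ?_)
  · have hs : p.real G + ε ≤ empFreq s G := hs
    unfold empFreq at hs
    rw [le_div_iff₀ hm'] at hs
    simp only [mem_ofPred_eq, hX, Finset.sum_sub_distrib, Finset.sum_const, Finset.card_univ,
      Fintype.card_fin, nsmul_eq_mul]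
    linarith
  · congr 1
    simp
    field_simp

/-- Uniform convergence of empirical frequencies over all sets with at most `R` switching points. -/
lemma samples_uniform_convergence (p : Measure ℝ) [IsProbabilityMeasure p] {m N R : ℕ} (hm : 0 < m)
    (hN : 0 < N) {ε : ℝ} (hε : 0 < ε) (hRN : (R : ℝ) ≤ ε * N)
    (hmle : Real.log 20 + R * Real.log (8 * N + 4) ≤ 2 * m * ε ^ 2) :
    (9 / 10 : ℝ≥0∞) ≤ samples p m {s | ∀ (u : Fin R → ℝ) (A : Set ℝ), MeasurableSet A →
      SwitchesAt u A → |empFreq s A - p.real A| ≤ 2 * ε} := by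
  obtain ⟨q, hq⟩ := exists_quantiles p N hN
  have hN' : (0 : ℝ) < N := by exact_mod_cast hN
  set E : Set (Fin m → ℝ) := {s | ∀ (u : Fin R → ℝ) (A : Set ℝ), MeasurableSet A →
      SwitchesAt u A → |empFreq s A - p.real A| ≤ 2 * ε} with hE
  have hsub : Eᶜ ⊆ ⋃ c : (Fin R → Fin (2 * N + 1)) × Finset (Fin (2 * R + 1)),
      {s | p.real (gridSet q c) + ε ≤ empFreq s (gridSet q c)} := by
    rw [compl_subset_comm]
    intro s hs u A hAm hA
    have hs : ∀ c : (Fin R → Fin (2 * N + 1)) × Finset (Fin (2 * R + 1)),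
        empFreq s (gridSet q c) < p.real (gridSet q c) + ε := by
      simpa using hs
    have upper : ∀ B : Set ℝ, MeasurableSet B → SwitchesAt u B →
        empFreq s B ≤ p.real B + 2 * ε := by
      intro B hBm hB
      obtain ⟨c, hc, hpc⟩ := exists_gridSet hq hB
      rw [measureReal_sdiff hc hBm] at hpc
      have h1 := empFreq_mono s hc
      have h2 := hs c
      have h3 : (R : ℝ) / N ≤ ε := by rwa [div_le_iff₀ hN']
      linarith
    have h1 := upper A hAm hA
    have h2 := upper Aᶜ hAm.compl hA.compl
    rw [empFreq_compl hm, probReal_compl_eq_one_sub hAm] at h2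
    rw [abs_le]
    constructor <;> linarith
  have hreal : (samples p m).real Eᶜ ≤ 1 / 10 := by
    calc (samples p m).real Eᶜ
        ≤ (samples p m).real (⋃ c : (Fin R → Fin (2 * N + 1)) × Finset (Fin (2 * R + 1)),
          {s | p.real (gridSet q c) + ε ≤ empFreq s (gridSet q c)}) := measureReal_mono hsub
      _ ≤ ∑ c : (Fin R → Fin (2 * N + 1)) × Finset (Fin (2 * R + 1)),
          (samples p m).real {s | p.real (gridSet q c) + ε ≤ empFreq s (gridSet q c)} :=
          measureReal_iUnion_fintype_le _
      _ ≤ ∑ _c : (Fin R → Fin (2 * N + 1)) × Finset (Fin (2 * R + 1)),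
          Real.exp (-2 * m * ε ^ 2) :=
          Finset.sum_le_sum fun c _ => samples_empFreq_ge p hm (measurableSet_gridSet q c) hε.le
      _ = (2 * N + 1) ^ R * 2 ^ (2 * R + 1) * Real.exp (-2 * m * ε ^ 2) := by
          simp [Finset.card_univ]
      _ = 2 * (8 * N + 4) ^ R * Real.exp (-2 * m * ε ^ 2) := by
          rw [show (8 * N + 4 : ℝ) = (2 * N + 1) * 4 by ring, mul_pow, pow_succ, pow_mul]
          norm_num
          ring
      _ ≤ 2 * (8 * N + 4) ^ R * Real.exp (-(Real.log 20 + R * Real.log (8 * N + 4))) := by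
          gcongr
          linarith
      _ = 1 / 10 := by
          rw [neg_add, Real.exp_add, Real.exp_neg, Real.exp_log (by norm_num), Real.exp_neg,
            mul_comm (R : ℝ), ← Real.rpow_def_of_pos (by positivity), Real.rpow_natCast]
          have : (8 * N + 4 : ℝ) ^ R ≠ 0 := by positivity
          field_simp
          norm_num
  have hone : (1 : ℝ≥0∞) ≤ samples p m E + samples p m Eᶜ := by
    rw [← measure_univ (μ := samples p m), ← union_compl_self E]
    exact measure_union_le _ _
  have hc : samples p m Eᶜ ≤ 1 / 10 := by
    have h := (ENNReal.le_ofReal_iff_toReal_le (measure_ne_top _ _) (by norm_num)).2 hreal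
    rwa [ENNReal.ofReal_div_of_pos (by norm_num), ENNReal.ofReal_one,
      show ENNReal.ofReal 10 = 10 by simp] at h
  have hten : (9 / 10 : ℝ≥0∞) + 1 / 10 = 1 := by
    rw [ENNReal.div_add_div_same, show (9 + 1 : ℝ≥0∞) = 10 by norm_num,
      ENNReal.div_self (by norm_num) (by norm_num)]
  have hfin : (1 / 10 : ℝ≥0∞) ≠ ⊤ := ENNReal.div_ne_top (by norm_num) (by norm_num)
  refine (ENNReal.add_le_add_iff_right hfin).1 ?_
  rw [hten]
  exact hone.trans (by gcongr)

/-- `g` vanishes to the left of `B`, and agrees with a polynomial of degree at most `d` from each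
point of `B` up to the next one. -/
def PiecewiseOn (B : Finset ℝ) (d : ℕ) (g : ℝ → ℝ) : Prop :=
  (∀ z ∈ B, ∃ P : Polynomial ℝ, P.natDegree ≤ d ∧
    ∀ y, z ≤ y → (∀ b ∈ B, z < b → y < b) → g y = P.eval y) ∧
  ∀ y, (∀ b ∈ B, y < b) → g y = 0

lemma exists_last_le (B : Finset ℝ) (y : ℝ) :
    (∀ b ∈ B, y < b) ∨ ∃ z ∈ B, z ≤ y ∧ ∀ b ∈ B, z < b → y < b := by
  by_cases h : (B.filter fun b => b ≤ y).Nonempty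
  · right
    have hm := Finset.mem_filter.1 (Finset.max'_mem _ h)
    refine ⟨_, hm.1, hm.2, fun b hb hlt => ?_⟩
    by_contra hle
    have hb' : b ∈ B.filter fun b => b ≤ y := Finset.mem_filter.2 ⟨hb, not_lt.1 hle⟩
    exact absurd hlt (not_lt.2 (Finset.le_max' _ b hb'))
  · left
    intro b hb
    by_contra hle
    exact h ⟨b, Finset.mem_filter.2 ⟨hb, not_lt.1 hle⟩⟩

lemma PiecewiseOn.mono {B B' : Finset ℝ} {d : ℕ} {g : ℝ → ℝ} (h : PiecewiseOn B d g)
    (hB : B ⊆ B') : PiecewiseOn B' d g := by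
  refine ⟨fun z _ => ?_, fun y hy => h.2 y fun b hb => hy b (hB hb)⟩
  rcases exists_last_le B z with hz | ⟨w, hw, hwz, hlast⟩
  · exact ⟨0, by simp, fun y _ hzy => by
      simpa using h.2 y fun b hb => hzy b (hB hb) (hz b hb)⟩
  · obtain ⟨P, hP, hPg⟩ := h.1 w hw
    exact ⟨P, hP, fun y hy hzy =>
      hPg y (hwz.trans hy) fun b hb hlt => hzy b (hB hb) (hlast b hb hlt)⟩

lemma PiecewiseOn.sub {B B' : Finset ℝ} {d : ℕ} {g g' : ℝ → ℝ} (h : PiecewiseOn B d g)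
    (h' : PiecewiseOn B' d g') : PiecewiseOn (B ∪ B') d fun y => g y - g' y := by
  have h1 := h.mono (Finset.subset_union_left (s₂ := B'))
  have h2 := h'.mono (Finset.subset_union_right (s₁ := B))
  refine ⟨fun z hz => ?_, fun y hy => by simp [h1.2 y hy, h2.2 y hy]⟩
  obtain ⟨P, hP, hPg⟩ := h1.1 z hz
  obtain ⟨Q, hQ, hQg⟩ := h2.1 z hz
  refine ⟨P - Q, (Polynomial.natDegree_sub_le P Q).trans (max_le hP hQ), fun y hy hzy => ?_⟩
  rw [Polynomial.eval_sub, ← hPg y hy hzy, ← hQg y hy hzy]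

lemma PiecewiseOn.measurable {B : Finset ℝ} {d : ℕ} {g : ℝ → ℝ} (h : PiecewiseOn B d g) :
    Measurable g := by
  choose! P hP hPg using h.1
  set T : ℝ → Set ℝ := fun z => {y | z ≤ y ∧ ∀ b ∈ B, z < b → y < b} with hT
  have hTm : ∀ z, MeasurableSet (T z) := by
    intro z
    have : T z = Ici z ∩ ⋂ b ∈ B, ⋂ _ : z < b, Iio b := by
      ext y; simp [hT]
    rw [this]
    exact measurableSet_Ici.inter (Finset.measurableSet_biInter B fun b _ =>
      MeasurableSet.iInter fun _ => measurableSet_Iio)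
  have hg : g = fun y => ∑ z ∈ B, (T z).indicator (fun y => (P z).eval y) y := by
    funext y
    rcases exists_last_le B y with hy | ⟨z, hz, hzy, hlast⟩
    · rw [h.2 y hy, Finset.sum_eq_zero]
      intro z hz
      exact indicator_of_notMem (fun hmem => absurd hmem.1 (not_le.2 (hy z hz))) _
    · rw [Finset.sum_eq_single z, indicator_of_mem (show y ∈ T z from ⟨hzy, hlast⟩)]
      · exact hPg z hz y hzy hlast
      · intro w hw hwz
        refine indicator_of_notMem (fun hmem => ?_) _
        rcases lt_or_gt_of_ne hwz with hlt | hlt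
        · exact absurd hzy (not_le.2 (hmem.2 z hz hlt))
        · exact absurd hmem.1 (not_le.2 (hlast w hw hlt))
      · exact fun hz' => absurd hz hz'
  rw [hg]
  exact Finset.measurable_sum _ fun z _ => (P z).continuous.measurable.indicator (hTm z)

lemma PiecewiseOn.exists_switches {B : Finset ℝ} {d R : ℕ} {g : ℝ → ℝ} (h : PiecewiseOn B d g)
    (hR : B.card * (d + 1) ≤ R) : ∃ u : Fin R → ℝ, SwitchesAt u {y | 0 < g y} := by
  classical
  choose! P hP hPg using h.1
  set S : Finset ℝ := B.biUnion fun z => insert z (P z).roots.toFinset with hS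
  have hSR : S.card ≤ R := by
    refine le_trans (Finset.card_biUnion_le_card_mul _ _ (d + 1) fun z hz => ?_) hR
    refine (Finset.card_insert_le _ _).trans (Nat.succ_le_succ ?_)
    exact (Multiset.toFinset_card_le _).trans ((Polynomial.card_roots' _).trans (hP z hz))
  refine ⟨fun i => S.toList.getD i 0, fun x y hxy hu => ?_⟩
  have hno : ∀ s ∈ S, s ∉ Icc x y := by
    intro s hs
    obtain ⟨i, hi, hsi⟩ := List.mem_iff_getElem.1 (Finset.mem_toList.2 hs)
    have hiR : i < R := lt_of_lt_of_le (by simpa using hi) hSR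
    have := hu ⟨i, hiR⟩
    simp only at this
    rwa [show S.toList.getD i 0 = s by rw [List.getD_eq_getElem _ _ hi, hsi]] at this
  have hBS : ∀ b ∈ B, b ∈ S := fun b hb =>
    Finset.mem_biUnion.2 ⟨b, hb, Finset.mem_insert_self _ _⟩
  have hBlt : ∀ b ∈ B, x < b → y < b := fun b hb hlt => by
    by_contra hle
    exact hno b (hBS b hb) ⟨hlt.le, not_lt.1 hle⟩
  simp only [mem_ofPred_eq]
  rcases exists_last_le B x with hx | ⟨z, hz, hzx, hlast⟩
  · rw [h.2 x hx, h.2 y fun b hb => hBlt b hb (hx b hb)]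
  rw [hPg z hz x hzx hlast, hPg z hz y (hzx.trans hxy) fun b hb hlt => hBlt b hb (hlast b hb hlt)]
  by_cases h0 : P z = 0
  · simp [h0]
  have hroot : ∀ w ∈ Icc x y, (P z).eval w ≠ 0 := fun w hw hw0 =>
    hno w (Finset.mem_biUnion.2 ⟨z, hz, Finset.mem_insert_of_mem (by simp [h0, hw0])⟩) hw
  constructor
  · intro hpos
    by_contra hneg
    obtain ⟨w, hw, hw0⟩ := intermediate_value_Icc' hxy (P z).continuous.continuousOn
      ⟨not_lt.1 hneg, hpos.le⟩
    exact hroot w hw hw0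
  · intro hpos
    by_contra hneg
    obtain ⟨w, hw, hw0⟩ := intermediate_value_Icc hxy (P z).continuous.continuousOn
      ⟨not_lt.1 hneg, hpos.le⟩
    exact hroot w hw hw0

lemma IsPiecewisePoly.piecewiseOn {a b : ℝ} {t d : ℕ} {f : ℝ → ℝ} (h : IsPiecewisePoly a b t d f) :
    ∃ B : Finset ℝ, B.card ≤ t + 1 ∧ PiecewiseOn B d ((Ico a b).indicator f) := by
  classical
  obtain ⟨x, hx0, hxt, hx, hP⟩ := h
  choose P hPd hPf using hP
  have hxa : ∀ i, a ≤ x i := fun i => hx0 ▸ hx (Fin.zero_le i)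
  have hxb : ∀ i, x i ≤ b := fun i => hxt ▸ hx (Fin.le_last i)
  have hmem : ∀ i, x i ∈ Finset.univ.image x := fun i =>
    Finset.mem_image_of_mem x (Finset.mem_univ i)
  refine ⟨Finset.univ.image x, Finset.card_image_le.trans (by simp), fun z hz => ?_,
    fun y hy => indicator_of_notMem (fun hm => absurd hm.1 (not_le.2 (hx0 ▸ hy _ (hmem 0)))) _⟩
  by_cases hi : ∃ i : Fin t, x i.castSucc = z ∧ z < x i.succ
  · obtain ⟨i, hiz, hlt⟩ := hi
    refine ⟨P i, hPd i, fun y hy hlast => ?_⟩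
    have hyi : y < x i.succ := hlast _ (hmem _) hlt
    have hmI : y ∈ Ico a b := ⟨(hxa i.castSucc).trans (hiz.trans_le hy), hyi.trans_le (hxb _)⟩
    rw [indicator_of_mem hmI]
    exact hPf i y ⟨hiz.trans_le hy, hyi⟩
  · refine ⟨0, by simp, fun y hy hlast => ?_⟩
    obtain ⟨k, -, rfl⟩ := Finset.mem_image.1 hz
    rw [Polynomial.eval_zero]
    refine indicator_of_notMem (fun hm => hi ?_) _
    have key : ∀ l : Fin (t + 1), x l ≤ x k := by
      intro l
      induction l using Fin.induction with
      | zero =>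
        by_contra hlt
        have := hlast _ (hmem 0) (not_le.1 hlt)
        exact absurd hm.1 (not_le.2 (hx0 ▸ this))
      | succ i ih =>
        by_contra hlt
        have hki : k ≤ i.castSucc := by
          by_contra hk
          exact hlt (hx (by
            rw [Fin.le_def]; rw [Fin.le_def] at hk; simp at hk ⊢; omega))
        exact hi ⟨i, le_antisymm ih (hx hki), not_le.1 hlt⟩
    exact absurd (hxt ▸ key (Fin.last t)) (not_le.2 (hy.trans_lt hm.2))

/-- `g` is a density of `q` with respect to Lebesgue measure. -/
structure HasRealDensity (q : Measure ℝ) (g : ℝ → ℝ) : Prop where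
  nonneg : ∀ y, 0 ≤ g y
  measurable : Measurable g
  integrable : Integrable g
  eq_withDensity : q = volume.withDensity fun y => ENNReal.ofReal (g y)

lemma IsPiecewisePolyDist.exists_density {q : Measure ℝ} {a b : ℝ} {t d : ℕ}
    (h : IsPiecewisePolyDist q a b t d) :
    ∃ (g : ℝ → ℝ) (B : Finset ℝ), B.card ≤ t + 1 ∧ PiecewiseOn B d g ∧ HasRealDensity q g := by
  obtain ⟨hq, f, hf, hqf, hpf⟩ := h
  obtain ⟨B, hB, hBf⟩ := hpf.piecewiseOn
  have heq : q = volume.withDensity fun y => ENNReal.ofReal ((Ico a b).indicator f y) := by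
    rw [hqf, ← withDensity_indicator measurableSet_Ico]
    congr 1
    funext y
    by_cases hy : y ∈ Ico a b <;> simp [hy]
  have hnn : ∀ y, 0 ≤ (Ico a b).indicator f y := fun y => indicator_nonneg hf y
  refine ⟨_, B, hB, hBf, hnn, hBf.measurable, ?_, heq⟩
  refine ⟨hBf.measurable.aestronglyMeasurable, ?_⟩
  rw [hasFiniteIntegral_iff_ofReal (Filter.Eventually.of_forall hnn),
    ← setLIntegral_univ, ← withDensity_apply _ MeasurableSet.univ, ← heq]
  exact measure_lt_top q univ

lemma HasRealDensity.real_eq {q : Measure ℝ} {g : ℝ → ℝ} (h : HasRealDensity q g) {A : Set ℝ}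
    (hA : MeasurableSet A) : q.real A = ∫ y in A, g y := by
  rw [measureReal_def, h.eq_withDensity, withDensity_apply _ hA,
    integral_eq_lintegral_of_nonneg_ae (Filter.Eventually.of_forall h.nonneg)
      h.measurable.aestronglyMeasurable]

lemma abs_sub_le_tvDist (p q : Measure ℝ) [IsProbabilityMeasure p] [IsProbabilityMeasure q]
    {A : Set ℝ} (hA : MeasurableSet A) : |p.real A - q.real A| ≤ tvDist p q := by
  refine le_ciSup (f := fun A : {S : Set ℝ // MeasurableSet S} =>
    |(p A.1).toReal - (q A.1).toReal|) ⟨1, ?_⟩ ⟨A, hA⟩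
  rintro _ ⟨S, rfl⟩
  have h1 : p.real S.1 ≤ 1 := measureReal_le_one
  have h2 : q.real S.1 ≤ 1 := measureReal_le_one
  have h3 : 0 ≤ p.real S.1 := measureReal_nonneg
  have h4 : 0 ≤ q.real S.1 := measureReal_nonneg
  rw [measureReal_def] at h1 h2 h3 h4
  exact abs_le.2 ⟨by linarith, by linarith⟩

lemma tvDist_le {p q : Measure ℝ} {r : ℝ}
    (h : ∀ A, MeasurableSet A → |p.real A - q.real A| ≤ r) : tvDist p q ≤ r :=
  have : Nonempty {S : Set ℝ // MeasurableSet S} := ⟨⟨∅, MeasurableSet.empty⟩⟩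
  ciSup_le fun A => h A.1 A.2

lemma tvDist_nonneg (p q : Measure ℝ) : 0 ≤ tvDist p q :=
  Real.iSup_nonneg fun _ => abs_nonneg _

lemma tvDist_le_one (p q : Measure ℝ) [IsProbabilityMeasure p] [IsProbabilityMeasure q] :
    tvDist p q ≤ 1 := by
  refine tvDist_le fun S _ => ?_
  have h1 : p.real S ≤ 1 := measureReal_le_one
  have h2 : q.real S ≤ 1 := measureReal_le_one
  have h3 : 0 ≤ p.real S := measureReal_nonneg
  have h4 : 0 ≤ q.real S := measureReal_nonneg
  exact abs_le.2 ⟨by linarith, by linarith⟩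

lemma tvDist_triangle (p q r : Measure ℝ) [IsProbabilityMeasure p] [IsProbabilityMeasure q]
    [IsProbabilityMeasure r] : tvDist p r ≤ tvDist p q + tvDist q r :=
  tvDist_le fun _ hA => (abs_sub_le _ _ _).trans
    (add_le_add (abs_sub_le_tvDist p q hA) (abs_sub_le_tvDist q r hA))

/-- Scheffé's identity: the set where one density exceeds the other attains the total variation
distance. -/
lemma tvDist_le_of_density {p q : Measure ℝ} [IsProbabilityMeasure p] [IsProbabilityMeasure q]
    {f g : ℝ → ℝ} (hf : HasRealDensity p f) (hg : HasRealDensity q g) :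
    tvDist p q ≤ p.real {y | 0 < f y - g y} - q.real {y | 0 < f y - g y} := by
  set A : Set ℝ := {y | 0 < f y - g y} with hA
  have hAm : MeasurableSet A := measurableSet_lt measurable_const (hf.measurable.sub hg.measurable)
  have hin : ∀ B, MeasurableSet B → B ⊆ A → q.real B ≤ p.real B := by
    intro B hB hBA
    rw [hf.real_eq hB, hg.real_eq hB]
    refine setIntegral_mono_on hg.integrable.integrableOn hf.integrable.integrableOn hB
      fun y hy => ?_
    have : 0 < f y - g y := hBA hy
    linarith
  have hout : ∀ B, MeasurableSet B → B ⊆ Aᶜ → p.real B ≤ q.real B := by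
    intro B hB hBA
    rw [hf.real_eq hB, hg.real_eq hB]
    refine setIntegral_mono_on hf.integrable.integrableOn hg.integrable.integrableOn hB
      fun y hy => ?_
    have : ¬ 0 < f y - g y := hBA hy
    linarith
  refine tvDist_le fun S hS => ?_
  have s1 := measureReal_inter_add_sdiff (μ := p) (s := S) hAm
  have s2 := measureReal_inter_add_sdiff (μ := q) (s := S) hAm
  have s3 := measureReal_inter_add_sdiff (μ := p) (s := A) hS
  have s4 := measureReal_inter_add_sdiff (μ := q) (s := A) hS
  have s5 := measureReal_inter_add_sdiff (μ := p) (s := Aᶜ) hS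
  have s6 := measureReal_inter_add_sdiff (μ := q) (s := Aᶜ) hS
  rw [probReal_compl_eq_one_sub hAm] at s5 s6
  rw [inter_comm] at s3 s4 s5 s6
  rw [← sdiff_eq] at s5 s6
  have i1 := hin (A \ S) (hAm.diff hS) sdiff_subset
  have i2 := hout (S \ A) (hS.diff hAm) (fun y hy => hy.2)
  have i3 := hout (Aᶜ \ S) (hAm.compl.diff hS) sdiff_subset
  have i4 := hin (S ∩ A) (hS.inter hAm) inter_subset_right
  rw [abs_le]
  constructor <;> linarith

lemma tvDist_le_integral {p q : Measure ℝ} {f g : ℝ → ℝ} (hf : HasRealDensity p f)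
    (hg : HasRealDensity q g) : tvDist p q ≤ ∫ y, |f y - g y| := by
  refine tvDist_le fun S hS => ?_
  rw [hf.real_eq hS, hg.real_eq hS,
    ← integral_sub hf.integrable.integrableOn hg.integrable.integrableOn]
  exact (abs_integral_le_integral_abs).trans (setIntegral_le_integral
    (hf.integrable.sub hg.integrable).abs (Filter.Eventually.of_forall fun _ => abs_nonneg _))

lemma exists_isPiecewisePolyDist {t : ℕ} (ht : 1 ≤ t) (d : ℕ) :
    ∃ q, IsPiecewisePolyDist q (-1) 1 t d := by
  refine ⟨_, ⟨?_⟩, fun _ => 1 / 2, fun _ _ => by norm_num, rfl,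
    fun i => if i = 0 then -1 else 1, by simp, ?_, ?_,
    fun i => ⟨Polynomial.C (1 / 2), by simp, by simp⟩⟩
  · rw [withDensity_apply _ MeasurableSet.univ]
    simp only [Measure.restrict_univ, lintegral_const, Measure.restrict_apply MeasurableSet.univ,
      univ_inter, Real.volume_Ico]
    rw [← ENNReal.ofReal_mul (by norm_num)]
    norm_num
  · have : Fin.last t ≠ 0 := by
      rw [Ne, Fin.ext_iff]; simp; omega
    simp [this]
  · intro i j hij
    by_cases hi : i = 0
    · by_cases hj : j = 0 <;> simp [hi, hj]
    · have hj : j ≠ 0 := by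
        rintro rfl; exact hi (le_antisymm hij (Fin.zero_le i))
      simp [hi, hj]

lemma IsPiecewisePolyDist.mono {q : Measure ℝ} {a b : ℝ} {t t' d : ℕ}
    (h : IsPiecewisePolyDist q a b t d) (htt : t ≤ t') : IsPiecewisePolyDist q a b t' d := by
  obtain ⟨hq, f, hf, hqf, x, hx0, hxt, hx, hP⟩ := h
  refine ⟨hq, f, hf, hqf, fun i => x ⟨min i t, by omega⟩, ?_, ?_, ?_, fun i => ?_⟩
  · rw [← hx0]; congr 1
  · rw [← hxt]; exact congrArg x (Fin.ext (by simpa using htt))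
  · intro i j hij
    have : (i : ℕ) ≤ j := hij
    exact hx (by rw [Fin.le_def]; simp; omega)
  · by_cases hi : (i : ℕ) < t
    · obtain ⟨P, hPd, hPf⟩ := hP ⟨i, hi⟩
      refine ⟨P, hPd, fun y hy => hPf y ?_⟩
      have e1 : (⟨min (i.castSucc : Fin (t' + 1)) t, by omega⟩ : Fin (t + 1))
          = (⟨i, hi⟩ : Fin t).castSucc := by ext; simp; omega
      have e2 : (⟨min (i.succ : Fin (t' + 1)) t, by omega⟩ : Fin (t + 1))
          = (⟨i, hi⟩ : Fin t).succ := by ext; simp; omega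
      simp only [e1, e2] at hy
      exact hy
    · refine ⟨0, by simp, fun y hy => ?_⟩
      have : (⟨min (i.castSucc : Fin (t' + 1)) t, by omega⟩ : Fin (t + 1))
          = ⟨min (i.succ : Fin (t' + 1)) t, by omega⟩ := by
        ext; simp; omega
      simp only [this] at hy
      exact absurd hy.2 (not_lt.2 hy.1)

/-- Piecewise polynomial distributions are separable in total variation distance. -/
lemma exists_dense_seq_isPiecewisePolyDist {t : ℕ} (ht : 1 ≤ t) (d : ℕ) :
    ∃ h : ℕ → Measure ℝ, (∀ n, IsPiecewisePolyDist (h n) (-1) 1 t d) ∧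
      ∀ q, IsPiecewisePolyDist q (-1) 1 t d → ∀ δ : ℝ, 0 < δ → ∃ n, tvDist q (h n) ≤ δ := by
  choose! g B hB hg hgd using
    fun (q : Measure ℝ) (h : IsPiecewisePolyDist q (-1) 1 t d) => h.exists_density
  let H := {q : Measure ℝ // IsPiecewisePolyDist q (-1) 1 t d}
  let Φ : H → Lp ℝ 1 (volume : Measure ℝ) := fun q => (hgd q.1 q.2).integrable.toL1 (g q.1)
  obtain ⟨q₀, hq₀⟩ := exists_isPiecewisePolyDist ht d
  have : Nonempty (range Φ) := ⟨⟨Φ ⟨q₀, hq₀⟩, mem_range_self _⟩⟩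
  have : Fact ((1 : ℝ≥0∞) ≠ ⊤) := ⟨ENNReal.one_ne_top⟩
  have : TopologicalSpace.SeparableSpace (range Φ) := inferInstance
  obtain ⟨v, hv⟩ := TopologicalSpace.exists_dense_seq (range Φ)
  choose w hw using fun n => (v n).2
  refine ⟨fun n => (w n).1, fun n => (w n).2, fun q hq δ hδ => ?_⟩
  obtain ⟨n, hn⟩ := hv.exists_dist_lt ⟨Φ ⟨q, hq⟩, mem_range_self _⟩ hδ
  refine ⟨n, (tvDist_le_integral (hgd q hq) (hgd _ (w n).2)).trans (le_trans (le_of_eq ?_) hn.le)⟩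
  rw [Subtype.dist_eq, ← hw n, dist_eq_norm, ← Integrable.toL1_sub, L1.norm_of_fun_eq_integral_norm]
  rfl

/-- Minimum distance estimation over a countable family of distributions with densities: if the
sample frequencies of all the sets on which one density exceeds another are within `η` of the
truth, the selected index is nearly three-competitive. -/
lemma exists_selector (m : ℕ) {h : ℕ → Measure ℝ} {g : ℕ → ℝ → ℝ}
    (hp : ∀ n, IsProbabilityMeasure (h n)) (hg : ∀ n, HasRealDensity (h n) (g n))
    {δ : ℝ} (hδ : 0 < δ) :
    ∃ σ : (Fin m → ℝ) → ℕ, Measurable σ ∧ ∀ (p : Measure ℝ) (_ : IsProbabilityMeasure p)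
      (s : Fin m → ℝ) (η : ℝ),
      (∀ i j, |empFreq s {y | 0 < g i y - g j y} - p.real {y | 0 < g i y - g j y}| ≤ η) →
      ∀ k, tvDist p (h (σ s)) ≤ 3 * tvDist p (h k) + 2 * η + δ := by
  classical
  set Y : ℕ × ℕ → Set ℝ := fun c => {y | 0 < g c.1 y - g c.2 y} with hY
  have hYm : ∀ c, MeasurableSet (Y c) := fun c =>
    measurableSet_lt measurable_const ((hg c.1).measurable.sub (hg c.2).measurable)
  set D : ℕ → (Fin m → ℝ) → ℝ := fun n s => ⨆ c, |(h n).real (Y c) - empFreq s (Y c)| with hD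
  have hDm : ∀ n, Measurable (D n) := fun n => Measurable.iSup fun c => by
    have := (measurable_empFreq (m := m) (hYm c)).const_sub ((h n).real (Y c))
    exact continuous_abs.measurable.comp this
  have hbdd : ∀ (n : ℕ) (s : Fin m → ℝ), BddAbove (range fun c => |(h n).real (Y c) - empFreq s (Y c)|) := by
    rintro n s
    refine ⟨1, ?_⟩
    rintro _ ⟨c, rfl⟩
    have h1 : (h n).real (Y c) ≤ 1 := measureReal_le_one
    have h2 : 0 ≤ (h n).real (Y c) := measureReal_nonneg
    have h3 := empFreq_nonneg s (Y c)
    have h4 := empFreq_le_one s (Y c)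
    exact abs_le.2 ⟨by linarith, by linarith⟩
  have hD0 : ∀ s, BddBelow (range fun n => D n s) := by
    intro s
    refine ⟨0, ?_⟩
    rintro _ ⟨n, rfl⟩
    exact Real.iSup_nonneg fun _ => abs_nonneg _
  have hex : ∀ s, ∃ n, D n s < (⨅ k, D k s) + δ := fun s =>
    exists_lt_of_ciInf_lt (by linarith)
  refine ⟨fun s => Nat.find (hex s), measurable_find hex fun n =>
    measurableSet_lt (hDm n) ((Measurable.iInf hDm).add_const δ), fun p hpp s η hη k => ?_⟩
  set n := Nat.find (hex s) with hn
  have hsel : D n s < (⨅ k, D k s) + δ := Nat.find_spec (hex s)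
  have hnk : D n s ≤ D k s + δ := by
    have := ciInf_le (hD0 s) k
    linarith
  have hk : D k s ≤ tvDist p (h k) + η := by
    refine ciSup_le fun c => ?_
    have h1 := abs_sub_le_tvDist p (h k) (hYm c)
    have h2 := hη c.1 c.2
    calc |(h k).real (Y c) - empFreq s (Y c)|
        ≤ |(h k).real (Y c) - p.real (Y c)| + |p.real (Y c) - empFreq s (Y c)| :=
          abs_sub_le _ _ _
      _ ≤ tvDist p (h k) + η := by
          rw [abs_sub_comm] at h1 h2
          exact add_le_add h1 h2
  have hkn : tvDist (h k) (h n) ≤ D k s + D n s := by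
    refine (tvDist_le_of_density (hg k) (hg n)).trans ?_
    have h1 := le_ciSup (hbdd k s) (k, n)
    have h2 := le_ciSup (hbdd n s) (k, n)
    have h3 := (abs_le.1 h1).2
    have h4 := (abs_le.1 h2).1
    change (h k).real (Y (k, n)) - (h n).real (Y (k, n)) ≤ D k s + D n s
    simp only [hD]
    linarith
  have := tvDist_triangle p (h k) (h n)
  linarith

lemma optTD_nonneg (p : Measure ℝ) (t d : ℕ) : 0 ≤ optTD p t d :=
  Real.sInf_nonneg (by rintro _ ⟨q, -, rfl⟩; exact tvDist_nonneg p q)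

lemma exists_learner {t : ℕ} (ht : 1 ≤ t) (d : ℕ) {m N : ℕ} (hm : 0 < m)
    (hN : 0 < N) {ε : ℝ} (hε : 0 < ε)
    (hRN : ((2 * (t + 1) * (d + 1) : ℕ) : ℝ) ≤ ε * N)
    (hmle : Real.log 20 + ((2 * (t + 1) * (d + 1) : ℕ) : ℝ) * Real.log (8 * N + 4)
      ≤ 2 * m * ε ^ 2) :
    ∃ A : (Fin m → ℝ) → Measure ℝ, Measurable A ∧
      (∀ s, IsPiecewisePolyDist (A s) (-1) 1 t d) ∧
      ∀ p : Measure ℝ, IsProbabilityMeasure p →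
        (9 / 10 : ℝ≥0∞) ≤ samples p m {s | tvDist p (A s) ≤ 3 * optTD p t d + 11 * ε} := by
  obtain ⟨h, hh, hdense⟩ := exists_dense_seq_isPiecewisePolyDist ht d
  choose g B hB hgB hg using fun n => (hh n).exists_density
  obtain ⟨σ, hσ, hsel⟩ := exists_selector m (fun n => (hh n).1) hg hε
  refine ⟨fun s => h (σ s), (measurable_from_top (f := h)).comp hσ, fun s => hh _,
    fun p hp => (samples_uniform_convergence p hm hN hε hRN hmle).trans
      (measure_mono fun s hs => ?_)⟩
  have hη : ∀ i j, |empFreq s {y | 0 < g i y - g j y} - p.real {y | 0 < g i y - g j y}|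
      ≤ 2 * ε := by
    intro i j
    have hpw := (hgB i).sub (hgB j)
    obtain ⟨u, hu⟩ := hpw.exists_switches (R := 2 * (t + 1) * (d + 1)) (by
      refine Nat.mul_le_mul_right _ ((Finset.card_union_le _ _).trans ?_)
      have := hB i
      have := hB j
      omega)
    exact hs u _ (measurableSet_lt measurable_const hpw.measurable) hu
  have hall := hsel p hp s (2 * ε) hη
  obtain ⟨q₀, hq₀⟩ := exists_isPiecewisePolyDist ht d
  obtain ⟨_, ⟨q, hq, rfl⟩, hqlt⟩ := exists_lt_of_csInf_lt
    (s := {x : ℝ | ∃ q : Measure ℝ, IsPiecewisePolyDist q (-1) 1 t d ∧ x = tvDist p q})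
    ⟨_, q₀, hq₀, rfl⟩ (show sInf _ < optTD p t d + ε from lt_add_of_pos_right _ hε)
  obtain ⟨k, hk⟩ := hdense q hq ε hε
  have := hq.1
  have := (hh k).1
  have htri := tvDist_triangle p q (h k)
  have := hall k
  change tvDist p (h (σ s)) ≤ _
  linarith

lemma log_le_five {x : ℝ} (hx : 0 < x) (h : x ≤ 64) : Real.log x ≤ 5 := by
  have h1 : Real.log x ≤ Real.log 64 := Real.log_le_log hx h
  have h2 : Real.log 64 = 6 * Real.log 2 := by
    rw [show (64 : ℝ) = 2 ^ 6 by norm_num, Real.log_pow]; norm_num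
  linarith [Real.log_two_lt_d9]

lemma sample_size_bound {k R ε : ℝ} {N : ℕ} (hk : 1 ≤ k) (hR0 : 0 ≤ R) (hR : R ≤ 4 * k)
    (hε : 0 < ε) (hε1 : ε < 1 / 100) (hN : (N : ℝ) ≤ R / ε + 1) :
    (Real.log 20 + R * Real.log (8 * N + 4)) / (2 * ε ^ 2) + 1
      ≤ 100 * k * Real.log (k / ε) / ε ^ 2 := by
  set L := Real.log (k / ε) with hL
  have hkε : 100 ≤ k / ε := by
    rw [le_div_iff₀ hε]; linarith
  have hL1 : 1 ≤ L := by
    rw [hL, Real.le_log_iff_exp_le (by linarith)]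
    linarith [Real.exp_one_lt_d9]
  have hN4 : (8 * N + 4 : ℝ) ≤ 44 * (k / ε) := by
    have : R / ε ≤ 4 * (k / ε) := by
      rw [← mul_div_assoc]; gcongr
    linarith
  have hlog : Real.log (8 * N + 4) ≤ 6 * L := by
    calc Real.log (8 * N + 4) ≤ Real.log (44 * (k / ε)) :=
          Real.log_le_log (by positivity) hN4
      _ = Real.log 44 + L := Real.log_mul (by norm_num) (by linarith)
      _ ≤ 6 * L := by linarith [log_le_five (x := 44) (by norm_num) (by norm_num)]
  have h20 : Real.log 20 ≤ 5 := log_le_five (by norm_num) (by norm_num)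
  have hkL : 1 ≤ k * L := by nlinarith
  have hRL : R * Real.log (8 * N + 4) ≤ 24 * (k * L) := by
    calc R * Real.log (8 * N + 4) ≤ R * (6 * L) := by gcongr
      _ ≤ 4 * k * (6 * L) := by gcongr
      _ = 24 * (k * L) := by ring
  have hε2 : ε ^ 2 ≤ 1 := by nlinarith
  rw [div_add_one (by positivity), div_le_div_iff₀ (by positivity) (by positivity)]
  have : Real.log 20 + R * Real.log (8 * N + 4) + 2 * ε ^ 2 ≤ 200 * (k * L) := by linarith
  nlinarith [mul_le_mul_of_nonneg_right this (sq_nonneg ε)]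

/-- Theorem thm:no-wb: learning piecewise polynomial distributions without any
well-behavedness assumption. -/
theorem learn_piecewise_polynomial_no_wb :
    ∃ C c : ℝ, 0 < C ∧ 0 < c ∧
      ∀ t d : ℕ, 1 ≤ t → ∀ ε : ℝ, 0 < ε → ε < 1 →
        ∃ (m : ℕ) (A : (Fin m → ℝ) → Measure ℝ),
          (m : ℝ) ≤ C * (t : ℝ) * ((d : ℝ) + 1) *
              (Real.log ((t : ℝ) * ((d : ℝ) + 1) / ε)) ^ c / ε ^ 2 ∧
          Measurable A ∧
          ∀ p : Measure ℝ, IsProbabilityMeasure p → p (Set.Ico (-1 : ℝ) 1) = 1 →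
            (9 / 10 : ℝ≥0∞) ≤ samples p m
              {s | IsPiecewisePolyDist (A s) (-1) 1 (2 * t - 1) d ∧
                   tvDist p (A s) ≤ 4 * optTD p t d * (1 + ε) + C * ε} := by
  refine ⟨100, 1, by norm_num, one_pos, fun t d ht ε hε hε1 => ?_⟩
  have ht' : (1 : ℝ) ≤ t := by exact_mod_cast ht
  have hd' : (0 : ℝ) ≤ d := Nat.cast_nonneg d
  have hk : 1 ≤ (t : ℝ) * ((d : ℝ) + 1) := by nlinarith
  have hpieces : t ≤ 2 * t - 1 := by omega
  rw [Real.rpow_one]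
  rcases le_or_gt (1 / 100) ε with hbig | hsmall
  · obtain ⟨q, hq⟩ := exists_isPiecewisePolyDist ht d
    have hlog : 0 ≤ Real.log ((t : ℝ) * ((d : ℝ) + 1) / ε) := by
      refine Real.log_nonneg ?_
      rw [le_div_iff₀ hε]; linarith
    refine ⟨0, fun _ => q, ?_, measurable_const, fun p hp _ => ?_⟩
    · rw [Nat.cast_zero]; positivity
    · have := hq.1
      have huniv : {s : Fin 0 → ℝ | IsPiecewisePolyDist q (-1) 1 (2 * t - 1) d ∧
          tvDist p q ≤ 4 * optTD p t d * (1 + ε) + 100 * ε} = univ := by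
        refine eq_univ_of_forall fun _ => ⟨hq.mono hpieces, ?_⟩
        have h1 := tvDist_le_one p q
        have h2 : 0 ≤ 4 * optTD p t d * (1 + ε) :=
          mul_nonneg (mul_nonneg (by norm_num) (optTD_nonneg p t d)) (by linarith)
        linarith
      rw [huniv, measure_univ]
      exact ENNReal.div_le_of_le_mul (by norm_num)
  · set R : ℕ := 2 * (t + 1) * (d + 1) with hR
    have hRk : (R : ℝ) ≤ 4 * (t * (d + 1)) := by
      rw [hR]; push_cast; nlinarith
    have hRpos : (0 : ℝ) < R := by rw [hR]; positivity
    set N : ℕ := ⌈(R : ℝ) / ε⌉₊ with hN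
    have hN1 : (N : ℝ) ≤ R / ε + 1 := (Nat.ceil_lt_add_one (by positivity)).le
    have hNpos : 0 < N := Nat.ceil_pos.2 (by positivity)
    have hRN : (R : ℝ) ≤ ε * N := by
      have := Nat.le_ceil ((R : ℝ) / ε)
      rwa [div_le_iff₀ hε, mul_comm] at this
    set x : ℝ := (Real.log 20 + R * Real.log (8 * N + 4)) / (2 * ε ^ 2) with hx
    have hxpos : 0 < x := by
      have h1 : 0 < Real.log 20 := Real.log_pos (by norm_num)
      have h2 : 0 ≤ Real.log (8 * N + 4) :=
        Real.log_nonneg (by linarith [(Nat.cast_nonneg N : (0 : ℝ) ≤ N)])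
      positivity
    have hmle : Real.log 20 + R * Real.log (8 * N + 4) ≤ 2 * ⌈x⌉₊ * ε ^ 2 := by
      have := Nat.le_ceil x
      rw [hx, div_le_iff₀ (by positivity), ← hx] at this
      linarith
    obtain ⟨A, hA, hAp, hAo⟩ := exists_learner ht d (Nat.ceil_pos.2 hxpos) hNpos hε hRN hmle
    refine ⟨⌈x⌉₊, A, ?_, hA, fun p hp _ => (hAo p hp).trans (measure_mono fun s hs =>
      ⟨(hAp s).mono hpieces, ?_⟩)⟩
    · refine (Nat.ceil_lt_add_one hxpos.le).le.trans ?_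
      rw [mul_assoc (100 : ℝ)]
      exact sample_size_bound hk hRpos.le hRk hε hsmall hN1
    · have hs : tvDist p (A s) ≤ 3 * optTD p t d + 11 * ε := hs
      have h0 := optTD_nonneg p t d
      nlinarith [mul_nonneg h0 hε.le]
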